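/- Let Q = (J,σ,ξ) be a Q-datum and 𝐢 a reduced word of w₀ adapted to Q. Suppose (ι,p) ∈ J × ℤ satisfies (ι, p−𝗌_{\barι}) ∈ Im Ω̃_Q and (ι, p+𝗌_{\barι}) ∈ Im Ω̃_Q. Then there is a unique 𝐦 ∈ ℤ^{R⁺} with Ω_Q(𝐦) = α_{\barι,p}, and it satisfies Σ_{α∈R⁺} 𝐦(α)·α = 0 in the root lattice Q_𝔰. -/

import Mathlib

open scoped BigOperators Classical

namespace QDatumPaper

structure CartanADE (J : Type) [Fintype J] [DecidableEq J] where
  a : J → J → ℤ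
  symm : ∀ ι j : J, a ι j = a j ι
  diag : ∀ ι : J, a ι ι = 2
  offDiag : ∀ ι j : J, ι ≠ j → a ι j = 0 ∨ a ι j = -1
  posDef : ∀ v : J → ℚ, v ≠ 0 → 0 < ∑ ι : J, ∑ j : J, v ι * (a ι j : ℚ) * v j
  indec : ∀ s : Set J, s.Nonempty →
    (∀ ι ∈ s, ∀ j : J, a ι j = -1 → j ∈ s) → s = Set.univ

variable {J : Type} [Fintype J] [DecidableEq J]

/-- `j` lies in the `σ`-orbit of `ι`. -/
def SameOrbit (σ : Equiv.Perm J) (ι j : J) : Prop := ∃ k : ℕ, (σ ^ k) ι = j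

/-- The size `𝗌_{\barι}` of the `σ`-orbit of `ι`. -/
noncomputable def orbitSize (σ : Equiv.Perm J) (ι : J) : ℕ :=
  ((Finset.range (orderOf σ)).image fun k => (σ ^ k) ι).card

/-- A diagram automorphism of the Cartan matrix `C`: no two distinct vertices in a common
orbit are adjacent. -/
structure DiagAut (C : CartanADE J) where
  σ : Equiv.Perm J
  compat : ∀ ι j : J, C.a (σ ι) (σ j) = C.a ι j
  noAdj : ∀ (ι : J) (k : ℕ), (σ ^ k) ι ≠ ι → C.a ι ((σ ^ k) ι) ≠ -1

/-- Height function on `(J, σ)`. -/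
def IsHeightFunction (C : CartanADE J) (D : DiagAut C) (ξ : J → ℤ) : Prop :=
  (∀ ι j : J, C.a ι j = -1 → orbitSize D.σ ι = orbitSize D.σ j →
      |ξ ι - ξ j| = (orbitSize D.σ ι : ℤ)) ∧
  (∀ ι j : J, C.a ι j = -1 → orbitSize D.σ ι < orbitSize D.σ j →
      ∃! j0 : J, SameOrbit D.σ j j0 ∧ |ξ ι - ξ j0| = 1 ∧
        ∀ k : ℕ, k < orderOf D.σ → ξ ((D.σ ^ k) j0) = ξ j0 - 2 * (k : ℤ))

/-- Symmetric bilinear form on the root lattice `ℤ^J`. -/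
def pairing (C : CartanADE J) (v w : J → ℤ) : ℤ := ∑ ι : J, ∑ j : J, v ι * C.a ι j * w j

/-- Positive roots. -/
def posRoots (C : CartanADE J) : Set (J → ℤ) :=
  {v | (∀ ι : J, 0 ≤ v ι) ∧ v ≠ 0 ∧ pairing C v v = 2}

def simpleRoot (ι : J) : J → ℤ := fun j => if j = ι then 1 else 0

/-- Simple reflection `s_ι` on the root lattice. -/
def reflS (C : CartanADE J) (ι : J) (v : J → ℤ) : J → ℤ :=
  fun j => v j - (∑ κ : J, v κ * C.a κ ι) * simpleRoot ι j

/-- `applyRefls C [ι₁, …, ι_m] v = s_{ι₁}(s_{ι₂}(⋯ s_{ι_m}(v)⋯))`. -/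
def applyRefls (C : CartanADE J) (w : List J) (v : J → ℤ) : J → ℤ :=
  w.foldr (reflS C) v

/-- `β_k = s_{ι₁} ⋯ s_{ι_{k-1}} (α_{ι_k})`. -/
def betaOf (C : CartanADE J) {L : ℕ} (ii : Fin L → J) (k : Fin L) : J → ℤ :=
  applyRefls C ((List.ofFn ii).take k.1) (simpleRoot (ii k))

/-- `ii` is a reduced word of the longest element. -/
def IsReducedWord (C : CartanADE J) {L : ℕ} (ii : Fin L → J) : Prop :=
  L = (posRoots C).ncard ∧ Function.Injective (betaOf C ii) ∧
    ∀ k : Fin L, betaOf C ii k ∈ posRoots C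

def pairingQ (C : CartanADE J) (v w : J → ℚ) : ℚ :=
  ∑ ι : J, ∑ j : J, v ι * (C.a ι j : ℚ) * w j

def reflQ (C : CartanADE J) (ι : J) (v : J → ℚ) : J → ℚ :=
  fun j => v j - (∑ κ : J, v κ * (C.a κ ι : ℚ)) * (if j = ι then 1 else 0)

def applyReflsQ (C : CartanADE J) (w : List J) (v : J → ℚ) : J → ℚ :=
  w.foldr (reflQ C) v

/-- `Λ` is a system of fundamental weights: `(Λ_ι, α_j) = δ_{ιj}`. -/
def IsFundWeights (C : CartanADE J) (Λ : J → J → ℚ) : Prop :=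
  ∀ ι j : J, pairingQ C (Λ ι) (fun κ => (simpleRoot j κ : ℚ)) = if ι = j then 1 else 0

/-- `ν_k = -(s_{ι₁} ⋯ s_{ι_k})(Λ_{ι_k})`. -/
def nuOf (C : CartanADE J) {L : ℕ} (ii : Fin L → J) (Λ : J → J → ℚ) (k : Fin L) : J → ℚ :=
  - applyReflsQ C ((List.ofFn ii).take (k.1 + 1)) (Λ (ii k))

def betaQ (C : CartanADE J) {L : ℕ} (ii : Fin L → J) (k : Fin L) : J → ℚ :=
  fun j => (betaOf C ii k j : ℚ)

/-- The pairing `(ν_k, β_t)`. -/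
def nuBetaPair (C : CartanADE J) {L : ℕ} (ii : Fin L → J) (Λ : J → J → ℚ) (k t : Fin L) : ℚ :=
  pairingQ C (nuOf C ii Λ k) (betaQ C ii t)

/-- `m` is a Kostant partition of `β`. -/
def IsKP (C : CartanADE J) (β : J → ℤ) (m : (J → ℤ) → ℤ) : Prop :=
  (∀ v : J → ℤ, v ∉ posRoots C → m v = 0) ∧ (∀ v ∈ posRoots C, 0 ≤ m v) ∧
    ∑ᶠ v ∈ posRoots C, m v • v = β

/-- `ρ^ii(m)_r = Σ_{t ≤ r} m(β_t)(ν_r, β_t)`. -/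
def rhoOf (C : CartanADE J) {L : ℕ} (ii : Fin L → J) (Λ : J → J → ℚ)
    (m : (J → ℤ) → ℤ) (r : Fin L) : ℚ :=
  ∑ t ∈ Finset.univ.filter (fun t : Fin L => t ≤ r),
    (m (betaOf C ii t) : ℚ) * nuBetaPair C ii Λ r t

/-- The partial order `≼_ii` on Kostant partitions. -/
def kpLE (C : CartanADE J) {L : ℕ} (ii : Fin L → J) (Λ : J → J → ℚ)
    (m n : (J → ℤ) → ℤ) : Prop :=
  ∀ r : Fin L, rhoOf C ii Λ m r ≤ rhoOf C ii Λ n r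

/-- The height function obtained from `ξ` by applying sources `w = [ι₁, …, ι_k]`. -/
noncomputable def heightAfter (σ : Equiv.Perm J) (ξ : J → ℤ) (w : List J) : J → ℤ :=
  w.foldl (fun η ι => fun j => η j - if j = ι then 2 * (orbitSize σ ι : ℤ) else 0) ξ

def IsSource (C : CartanADE J) (ξ : J → ℤ) (ι : J) : Prop :=
  ∀ j : J, C.a ι j = -1 → ξ j < ξ ι

/-- `ii` is adapted to the Q-datum `(J, σ, ξ)`. -/
def IsAdapted (C : CartanADE J) (D : DiagAut C) (ξ : J → ℤ) {L : ℕ} (ii : Fin L → J) : Prop :=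
  ∀ k : Fin L, IsSource C (heightAfter D.σ ξ ((List.ofFn ii).take k.1)) (ii k)

/-- `(s_{ι_{k-1}} ⋯ s_{ι_1} ξ)_{ι_k}`, the second component of `Ω̃_Q(β_k)`. -/
noncomputable def heightAt (σ : Equiv.Perm J) (ξ : J → ℤ) {L : ℕ} (ii : Fin L → J) (k : Fin L) : ℤ :=
  heightAfter σ ξ ((List.ofFn ii).take k.1) (ii k)

/-- `x ∈ Im Ω̃_Q`. -/
def InImOmega (σ : Equiv.Perm J) (ξ : J → ℤ) {L : ℕ} (ii : Fin L → J) (x : J × ℤ) : Prop :=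
  ∃ k : Fin L, ii k = x.1 ∧ heightAt σ ξ ii k = x.2

/-- A single commutation move. -/
def CommStep (C : CartanADE J) {L : ℕ} (ii jj : Fin L → J) : Prop :=
  ∃ (k : ℕ) (h1 : k < L) (h2 : k + 1 < L),
    C.a (ii ⟨k, h1⟩) (ii ⟨k + 1, h2⟩) = 0 ∧
    jj = ii ∘ Equiv.swap (⟨k, h1⟩ : Fin L) ⟨k + 1, h2⟩

/-- Commutation equivalence of words. -/
def CommEquiv (C : CartanADE J) {L : ℕ} (ii jj : Fin L → J) : Prop :=
  Relation.ReflTransGen (CommStep C) ii jj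

/-- The orbits of `ι` and `j` are adjacent (`\barι ∼ \barj` in `I₀`). -/
def adjOrbit (C : CartanADE J) (σ : Equiv.Perm J) (ι j : J) : Prop :=
  ∃ ι' j' : J, SameOrbit σ ι ι' ∧ SameOrbit σ j j' ∧ C.a ι' j' = -1

/-- `c ι j` is the Cartan matrix `c_{\barι \barj}` of the folded algebra `𝔤₀`. -/
noncomputable def IsFoldedCartan (C : CartanADE J) (σ : Equiv.Perm J) (c : J → J → ℤ) : Prop :=
  ∀ ι j : J, (c ι j : ℚ) =
    if SameOrbit σ ι j then 2
    else if adjOrbit C σ ι j then -(max 1 ((orbitSize σ j : ℚ) / (orbitSize σ ι : ℚ)))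
    else 0

/-- The basis element `ϖ_{\barι, p}` of `𝒫_ℤ`, realized as a function on `J × ℤ`
(the indicator of `orbit(ι) × {p}`). -/
noncomputable def varpiF (σ : Equiv.Perm J) (ι : J) (p : ℤ) : (J × ℤ) → ℤ :=
  fun y => if SameOrbit σ ι y.1 ∧ y.2 = p then 1 else 0

/-- The ℓ-root `α_{\barι, p}`. -/
noncomputable def lrootF (σ : Equiv.Perm J) (c : J → J → ℤ) (ι : J) (p : ℤ) : (J × ℤ) → ℤ :=
  fun y => varpiF σ ι (p + (orbitSize σ ι : ℤ)) y + varpiF σ ι (p - (orbitSize σ ι : ℤ)) y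
    - (if (¬ SameOrbit σ ι y.1) ∧
          ∃ k : ℤ, 1 ≤ k ∧ k ≤ -(c y.1 ι) ∧ y.2 = p - c y.1 ι + 1 - 2 * k
       then 1 else 0)

/-- `(\barι, p + 𝗌_{\barι}) ∈ Î₀`, i.e. the index `(\barι,p)` gives a valid ℓ-root. -/
def ValidLRootIdx (σ : Equiv.Perm J) (ξ : J → ℤ) (ι : J) (p : ℤ) : Prop :=
  (2 : ℤ) ∣ (p + (orbitSize σ ι : ℤ) - ξ ι)

/-- The set of all ℓ-roots (generating `𝒬_ℤ`). -/
noncomputable def lrootSet (σ : Equiv.Perm J) (ξ : J → ℤ) (c : J → J → ℤ) :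
    Set ((J × ℤ) → ℤ) :=
  {x | ∃ (ι : J) (p : ℤ), ValidLRootIdx σ ξ ι p ∧ x = lrootF σ c ι p}

/-- The ℤ-linear map `Ω_Q : ℤ^{R⁺} → 𝒫_ℤ`. -/
noncomputable def OmegaQmap (C : CartanADE J) (σ : Equiv.Perm J) (ξ : J → ℤ) {L : ℕ}
    (ii : Fin L → J) (m : (J → ℤ) → ℤ) : (J × ℤ) → ℤ :=
  ∑ k : Fin L, m (betaOf C ii k) • varpiF σ (ii k) (heightAt σ ξ ii k)

/-! ### Orbits -/

lemma orbitSize_eq (σ : Equiv.Perm J) (ι : J) :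
    orbitSize σ ι = Function.minimalPeriod σ ι := by
  unfold orbitSize
  have hpos : 0 < Function.minimalPeriod σ ι :=
    Function.minimalPeriod_pos_of_mem_periodicPts
      ⟨orderOf σ, orderOf_pos σ, by
        show σ^[orderOf σ] ι = ι
        rw [← Equiv.Perm.coe_pow, pow_orderOf_eq_one]; rfl⟩
  have hle : Function.minimalPeriod σ ι ≤ orderOf σ := by
    apply Function.IsPeriodicPt.minimalPeriod_le (orderOf_pos σ)
    show σ^[orderOf σ] ι = ι
    rw [← Equiv.Perm.coe_pow, pow_orderOf_eq_one]; rfl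
  have h1 : ((Finset.range (orderOf σ)).image fun k => (σ ^ k) ι)
      = (Finset.range (Function.minimalPeriod σ ι)).image fun k => σ^[k] ι := by
    ext x
    simp only [Finset.mem_image, Finset.mem_range, Equiv.Perm.coe_pow]
    constructor
    · rintro ⟨k, _, rfl⟩
      exact ⟨k % Function.minimalPeriod σ ι, Nat.mod_lt _ hpos,
        Function.iterate_mod_minimalPeriod_eq⟩
    · rintro ⟨k, hk, rfl⟩
      exact ⟨k, by omega, rfl⟩
  rw [h1, Finset.card_image_of_injOn, Finset.card_range]
  intro a ha b hb hab
  exact Function.iterate_injOn_Iio_minimalPeriod (by simpa using ha) (by simpa using hb) hab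

lemma orbitSize_pos (σ : Equiv.Perm J) (ι : J) : 0 < orbitSize σ ι := by
  rw [orbitSize_eq]
  exact Function.minimalPeriod_pos_of_mem_periodicPts
      ⟨orderOf σ, orderOf_pos σ, by
        show σ^[orderOf σ] ι = ι
        rw [← Equiv.Perm.coe_pow, pow_orderOf_eq_one]; rfl⟩

lemma orbitSize_le (σ : Equiv.Perm J) (ι : J) : orbitSize σ ι ≤ orderOf σ := by
  rw [orbitSize_eq]
  apply Function.IsPeriodicPt.minimalPeriod_le (orderOf_pos σ)
  show σ^[orderOf σ] ι = ι
  rw [← Equiv.Perm.coe_pow, pow_orderOf_eq_one]; rfl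

lemma pow_orbitSize (σ : Equiv.Perm J) (ι : J) : (σ ^ orbitSize σ ι) ι = ι := by
  rw [orbitSize_eq, Equiv.Perm.coe_pow]
  exact Function.iterate_minimalPeriod

lemma pow_ne_of_lt (σ : Equiv.Perm J) (ι : J) {n : ℕ} (h0 : 0 < n) (h : n < orbitSize σ ι) :
    (σ ^ n) ι ≠ ι := by
  rw [orbitSize_eq] at h
  rw [Equiv.Perm.coe_pow]
  exact Function.not_isPeriodicPt_of_pos_of_lt_minimalPeriod h0.ne' h

lemma orbitSize_eq_one_iff (σ : Equiv.Perm J) (ι : J) : orbitSize σ ι = 1 ↔ σ ι = ι := by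
  constructor
  · intro h
    have := pow_orbitSize σ ι
    rwa [h, pow_one] at this
  · intro h
    have h1 := orbitSize_pos σ ι
    by_contra h2
    exact pow_ne_of_lt σ ι one_pos (by omega) (by simpa using h)

lemma SameOrbit.refl' (σ : Equiv.Perm J) (ι : J) : SameOrbit σ ι ι := ⟨0, rfl⟩

lemma SameOrbit.trans' {σ : Equiv.Perm J} {a b c : J} (h : SameOrbit σ a b)
    (h' : SameOrbit σ b c) : SameOrbit σ a c := by
  obtain ⟨k, rfl⟩ := h
  obtain ⟨l, rfl⟩ := h'
  exact ⟨l + k, by rw [pow_add]; rfl⟩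

lemma SameOrbit.symm' {σ : Equiv.Perm J} {a b : J} (h : SameOrbit σ a b) :
    SameOrbit σ b a := by
  obtain ⟨k, rfl⟩ := h
  refine ⟨orderOf σ * k - k, ?_⟩
  have hk : k ≤ orderOf σ * k := Nat.le_mul_of_pos_left _ (orderOf_pos σ)
  rw [← Equiv.Perm.mul_apply, ← pow_add, Nat.sub_add_cancel hk, pow_mul, pow_orderOf_eq_one,
    one_pow]
  rfl

lemma sameOrbit_pow (σ : Equiv.Perm J) (a : J) (k : ℕ) : SameOrbit σ a ((σ ^ k) a) := ⟨k, rfl⟩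

lemma SameOrbit.size {σ : Equiv.Perm J} {a b : J} (h : SameOrbit σ a b) :
    orbitSize σ a = orbitSize σ b := by
  obtain ⟨k, rfl⟩ := h
  rw [orbitSize_eq, orbitSize_eq, Equiv.Perm.coe_pow]
  refine (Function.minimalPeriod_apply_iterate ?_ k).symm
  exact ⟨orderOf σ, orderOf_pos σ, by
        show σ^[orderOf σ] a = a
        rw [← Equiv.Perm.coe_pow, pow_orderOf_eq_one]; rfl⟩

lemma SameOrbit.exists_lt {σ : Equiv.Perm J} {a b : J} (h : SameOrbit σ a b) :
    ∃ k, k < orderOf σ ∧ (σ ^ k) a = b := by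
  obtain ⟨k, rfl⟩ := h
  exact ⟨k % orderOf σ, Nat.mod_lt _ (orderOf_pos σ), by rw [pow_mod_orderOf]⟩

lemma compat_pow {C : CartanADE J} (D : DiagAut C) (k : ℕ) (i j : J) :
    C.a ((D.σ ^ k) i) ((D.σ ^ k) j) = C.a i j := by
  induction k with
  | zero => rfl
  | succ n ih =>
    rw [pow_succ']
    simp only [Equiv.Perm.mul_apply]
    rw [D.compat, ih]

lemma adj_ne {C : CartanADE J} {i j : J} (h : C.a i j = -1) : i ≠ j := by
  rintro rfl
  rw [C.diag] at h
  omega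

lemma adj_not_same {C : CartanADE J} (D : DiagAut C) {i j : J} (h : C.a i j = -1) :
    ¬ SameOrbit D.σ i j := by
  rintro ⟨k, rfl⟩
  exact D.noAdj i k (fun h' => adj_ne h h'.symm) h

/-- If `i ∼ j` then any point of the orbit of `i` is adjacent to a point of the orbit of `j`. -/
lemma adj_transport {C : CartanADE J} (D : DiagAut C) {i j i' : J} (h : C.a i j = -1)
    (h' : SameOrbit D.σ i i') : ∃ j', SameOrbit D.σ j j' ∧ C.a i' j' = -1 := by
  obtain ⟨k, rfl⟩ := h'
  exact ⟨(D.σ ^ k) j, ⟨k, rfl⟩, by rw [compat_pow, h]⟩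

/-! ### Positive definiteness -/

lemma posDef_contra (C : CartanADE J) (x : J → ℤ) (h0 : ∀ i, 0 ≤ x i) (hne : ∃ i, x i ≠ 0)
    (h : ∀ i, 0 < x i → ∑ j, C.a i j * x j ≤ 0) : False := by
  have := C.posDef (fun i => (x i : ℚ)) (by
    obtain ⟨i, hi⟩ := hne
    intro h
    have := congrFun h i
    simp at this
    exact hi this)
  have h2 : ∑ i, ∑ j, x i * C.a i j * x j ≤ 0 := by
    apply Finset.sum_nonpos
    intro i _
    have : ∑ j, x i * C.a i j * x j = x i * ∑ j, C.a i j * x j := by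
      rw [Finset.mul_sum]
      exact Finset.sum_congr rfl fun j _ => by ring
    rw [this]
    rcases (h0 i).eq_or_lt with h1 | h1
    · simp [← h1]
    · exact mul_nonpos_of_nonneg_of_nonpos h1.le (h i h1)
  have h3 : ((∑ i, ∑ j, x i * C.a i j * x j : ℤ) : ℚ) ≤ 0 := by exact_mod_cast h2
  push_cast at h3
  linarith

lemma row_le (C : CartanADE J) (x : J → ℤ) (h0 : ∀ i, 0 ≤ x i) (i : J) (T : Finset J)
    (hT : ∀ j ∈ T, C.a i j = -1) : ∑ j, C.a i j * x j ≤ 2 * x i - ∑ j ∈ T, x j := by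
  have hi : i ∉ T := fun h => adj_ne (hT i h) rfl
  have h1 : ∑ j ∈ insert i T, C.a i j * x j = 2 * x i - ∑ j ∈ T, x j := by
    rw [Finset.sum_insert hi, C.diag, sub_eq_add_neg, ← Finset.sum_neg_distrib]
    congr 1
    exact Finset.sum_congr rfl fun j hj => by rw [hT j hj]; ring
  rw [← h1, ← Finset.sum_sdiff (Finset.subset_univ (insert i T))]
  have : ∑ j ∈ Finset.univ \ insert i T, C.a i j * x j ≤ 0 := by
    apply Finset.sum_nonpos
    intro j hj
    have hij : i ≠ j := by
      rintro rfl
      simp at hj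
    have := h0 j
    rcases C.offDiag i j hij with h | h <;> rw [h] <;> linarith
  linarith

/-- Connectedness of a subset of the diagram. -/
def ConnSub (C : CartanADE J) (U : Set J) : Prop :=
  ∀ s : Set J, s ⊆ U → s.Nonempty → (∀ i ∈ s, ∀ j ∈ U, C.a i j = -1 → j ∈ s) → s = U

def InvSub (σ : Equiv.Perm J) (U : Set J) : Prop :=
  ∀ i j, SameOrbit σ i j → i ∈ U → j ∈ U

def TwoNbr (C : CartanADE J) (U : Set J) (u : J) : Prop :=
  ∃ a ∈ U, ∃ b ∈ U, a ≠ b ∧ C.a u a = -1 ∧ C.a u b = -1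

lemma TwoNbr.transport {C : CartanADE J} (D : DiagAut C) {U : Set J} (hU : InvSub D.σ U)
    {u v : J} (huv : SameOrbit D.σ u v) (h : TwoNbr C U u) : TwoNbr C U v := by
  obtain ⟨a, ha, b, hb, hab, h1, h2⟩ := h
  obtain ⟨k, rfl⟩ := huv
  refine ⟨(D.σ ^ k) a, hU _ _ ⟨k, rfl⟩ ha, (D.σ ^ k) b, hU _ _ ⟨k, rfl⟩ hb, ?_, ?_, ?_⟩
  · exact fun h => hab ((D.σ ^ k).injective h)
  · rw [compat_pow, h1]
  · rw [compat_pow, h2]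

lemma remove_leaf {C : CartanADE J} (D : DiagAut C) {U : Set J} (hU : InvSub D.σ U)
    (hc : ConnSub C U) {u : J} (hn : ¬ TwoNbr C U u) :
    InvSub D.σ {x ∈ U | ¬ SameOrbit D.σ u x} ∧ ConnSub C {x ∈ U | ¬ SameOrbit D.σ u x} := by
  constructor
  · rintro i j hij ⟨h1, h2⟩
    exact ⟨hU i j hij h1, fun h => h2 (h.trans' hij.symm')⟩
  · intro s hs hne hcl
    have key := hc (s ∪ {x ∈ U | SameOrbit D.σ u x ∧ ∃ y ∈ s, C.a x y = -1}) ?_ ?_ ?_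
    · apply Set.Subset.antisymm hs
      rintro x ⟨hx, hx'⟩
      rw [← key] at hx
      rcases hx with hx | hx
      · exact hx
      · exact absurd hx.2.1 hx'
    · rintro x (hx | hx)
      · exact (hs hx).1
      · exact hx.1
    · exact hne.mono Set.subset_union_left
    · rintro i (hi | ⟨hi, hui, y, hy, hiy⟩) j hj hij
      · by_cases h : SameOrbit D.σ u j
        · exact Or.inr ⟨hj, h, i, hi, by rw [C.symm, hij]⟩
        · exact Or.inl (hcl i hi j ⟨hj, h⟩ hij)
      · left
        by_contra hjs
        apply hn
        refine TwoNbr.transport D hU hui.symm' ⟨y, (hs hy).1, j, hj, ?_, hiy, hij⟩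
        rintro rfl
        exact hjs hy

lemma connSub_univ (C : CartanADE J) : ConnSub C Set.univ := by
  intro s _ hne h
  exact C.indec s hne fun i hi j hij => h i hi j (Set.mem_univ _) hij

lemma connSub_two {C : CartanADE J} {U : Set J} (hc : ConnSub C U) {u v : J} (hu : u ∈ U)
    (hv : v ∈ U) (huv : u ≠ v) : ∃ w ∈ U, C.a u w = -1 := by
  by_contra h
  push Not at h
  have := hc {u} (by simpa using hu) ⟨u, rfl⟩ (by
    rintro i rfl j hj hij
    exact absurd hij (h j hj))
  rw [← this] at hv
  exact huv hv.symm

lemma exists_fixed {C : CartanADE J} (D : DiagAut C) (ι : J) : ∃ f : J, D.σ f = f := by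
  obtain ⟨U, ⟨hU1, hU2, hU3⟩, hmin⟩ := exists_minimal_of_wellFoundedLT
    (fun U : Set J => InvSub D.σ U ∧ ConnSub C U ∧ U.Nonempty)
    ⟨Set.univ, fun _ _ _ _ => Set.mem_univ _, connSub_univ C, ⟨ι, Set.mem_univ _⟩⟩
  by_cases hT : ∀ u ∈ U, TwoNbr C U u
  · exfalso
    refine posDef_contra C (fun i => if i ∈ U then 1 else 0) ?_ ?_ ?_
    · intro i; split_ifs <;> norm_num
    · obtain ⟨i, hi⟩ := hU3
      exact ⟨i, by simp [hi]⟩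
    · intro i hi
      have hi : i ∈ U := by by_contra h; simp [h] at hi
      obtain ⟨a, ha, b, hb, hab, h1, h2⟩ := hT i hi
      refine (row_le C _ ?_ i {a, b} ?_).trans ?_
      · intro i; split_ifs <;> norm_num
      · intro j hj
        simp only [Finset.mem_insert, Finset.mem_singleton] at hj
        rcases hj with rfl | rfl <;> assumption
      · rw [Finset.sum_pair hab]
        simp [hi, ha, hb]
  · push Not at hT
    obtain ⟨u, hu, hn⟩ := hT
    obtain ⟨h1, h2⟩ := remove_leaf D hU1 hU2 hn
    by_contra hf
    push Not at hf
    have hσu : D.σ u ∈ U := hU1 _ _ ⟨1, by simp⟩ hu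
    obtain ⟨w, hw, huw⟩ := connSub_two hU2 hu hσu (hf u).symm
    have := hmin ⟨h1, h2, ⟨w, hw, adj_not_same D huw⟩⟩ (fun x hx => hx.1) hu
    exact this.2 (SameOrbit.refl' _ _)

lemma size_one_of_lt {C : CartanADE J} (D : DiagAut C) {ι j : J} (hij : C.a ι j = -1)
    (hlt : orbitSize D.σ ι < orbitSize D.σ j) : orbitSize D.σ ι = 1 := by
  by_contra hs
  have hσι : D.σ ι ≠ ι := fun h => hs ((orbitSize_eq_one_iff _ _).2 h)
  obtain ⟨U, ⟨hU1, hU2, hU3⟩, hmin⟩ := exists_minimal_of_wellFoundedLT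
    (fun U : Set J => InvSub D.σ U ∧ ConnSub C U ∧ ι ∈ U)
    ⟨Set.univ, fun _ _ _ _ => Set.mem_univ _, connSub_univ C, Set.mem_univ _⟩
  have hT : ∀ u ∈ U, ¬ SameOrbit D.σ ι u → TwoNbr C U u := by
    intro u hu hne
    by_contra hn
    obtain ⟨h1, h2⟩ := remove_leaf D hU1 hU2 hn
    have := hmin ⟨h1, h2, ⟨hU3, fun h => hne h.symm'⟩⟩ (fun x hx => hx.1) hu
    exact this.2 (SameOrbit.refl' _ _)
  obtain ⟨w, hw, hιw⟩ := connSub_two hU2 hU3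
    (hU1 _ _ (⟨1, by simp⟩ : SameOrbit D.σ ι (D.σ ι)) hU3) hσι.symm
  set x : J → ℤ := fun i => if i ∈ U then 2 else if SameOrbit D.σ j i then 1 else 0 with hx
  have hx0 : ∀ i, 0 ≤ x i := by
    intro i; simp only [hx]; split_ifs <;> norm_num
  have hxU : ∀ i ∈ U, x i = 2 := by intro i hi; simp [hx, hi]
  have htwo : ∀ i ∈ U, TwoNbr C U i → ∑ j, C.a i j * x j ≤ 0 := by
    rintro i hi ⟨a, ha, b, hb, hab, h1, h2⟩
    refine (row_le C _ hx0 i {a, b} ?_).trans ?_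
    · intro j hj
      simp only [Finset.mem_insert, Finset.mem_singleton] at hj
      rcases hj with rfl | rfl <;> assumption
    · rw [Finset.sum_pair hab, hxU i hi, hxU a ha, hxU b hb]
      norm_num
  refine posDef_contra C x hx0 ⟨ι, by rw [hxU ι hU3]; norm_num⟩ ?_
  intro i hi
  by_cases hiU : i ∈ U
  · by_cases hιi : SameOrbit D.σ ι i
    · obtain ⟨k, rfl⟩ := hιi
      set j1 := (D.σ ^ k) j
      set j2 := (D.σ ^ k) ((D.σ ^ orbitSize D.σ ι) j)
      have hj1 : C.a ((D.σ ^ k) ι) j1 = -1 := by rw [compat_pow, hij]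
      have hj2 : C.a ((D.σ ^ k) ι) j2 = -1 := by
        rw [compat_pow]
        conv_lhs => rw [← pow_orbitSize D.σ ι]
        rw [pow_orbitSize D.σ ι]
        have := compat_pow D (orbitSize D.σ ι) ι j
        rw [pow_orbitSize, hij] at this
        exact this
      have hj12 : j1 ≠ j2 := fun h => pow_ne_of_lt D.σ j (orbitSize_pos _ _) hlt
        ((D.σ ^ k).injective h).symm
      have hs1 : SameOrbit D.σ j j1 := ⟨k, rfl⟩
      have hs2 : SameOrbit D.σ j j2 := (sameOrbit_pow D.σ j _).trans' ⟨k, rfl⟩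
      by_cases hjU : j ∈ U
      · exact htwo _ hiU ⟨j1, hU1 _ _ hs1 hjU, j2, hU1 _ _ hs2 hjU, hj12, hj1, hj2⟩
      · have hn1 : j1 ∉ U := fun h => hjU (hU1 _ _ hs1.symm' h)
        have hn2 : j2 ∉ U := fun h => hjU (hU1 _ _ hs2.symm' h)
        have hwk : (D.σ ^ k) w ∈ U := hU1 _ _ ⟨k, rfl⟩ hw
        refine (row_le C _ hx0 _ {(D.σ ^ k) w, j1, j2} ?_).trans ?_
        · intro j hj
          simp only [Finset.mem_insert, Finset.mem_singleton] at hj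
          rcases hj with rfl | rfl | rfl
          · rw [compat_pow, hιw]
          · exact hj1
          · exact hj2
        · rw [Finset.sum_insert, Finset.sum_pair hj12, hxU _ hiU, hxU _ hwk]
          · have e1 : x j1 = 1 := by simp [hx, hn1, hs1]
            have e2 : x j2 = 1 := by simp [hx, hn2, hs2]
            rw [e1, e2]; norm_num
          · simp only [Finset.mem_insert, Finset.mem_singleton, not_or]
            exact ⟨fun h => hn1 (h ▸ hwk), fun h => hn2 (h ▸ hwk)⟩
    · exact htwo i hiU (hT i hiU hιi)
  · have hji : SameOrbit D.σ j i := by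
      by_contra h
      simp [hx, hiU, h] at hi
    obtain ⟨ι', h1, h2⟩ := adj_transport D (by rw [C.symm, hij] : C.a j ι = -1) hji
    refine (row_le C _ hx0 i {ι'} ?_).trans ?_
    · intro j hj
      rw [Finset.mem_singleton] at hj
      rw [hj, h2]
    · rw [Finset.sum_singleton, hxU ι' (hU1 _ _ h1 hU3)]
      simp [hx, hiU, hji]

/-! ### Height functions -/

lemma size_top {C : CartanADE J} {D : DiagAut C} {ξ : J → ℤ} (hξ : IsHeightFunction C D ξ)
    {ι j : J} (hij : C.a ι j = -1) (hlt : orbitSize D.σ ι < orbitSize D.σ j) :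
    orbitSize D.σ j = orderOf D.σ := by
  obtain ⟨j0, ⟨h1, -, h3⟩, -⟩ := hξ.2 ι j hij hlt
  by_contra hne
  have hlt' : orbitSize D.σ j < orderOf D.σ := lt_of_le_of_ne (orbitSize_le _ _) hne
  have := h3 _ hlt'
  rw [h1.size, pow_orbitSize] at this
  have := orbitSize_pos D.σ j0
  omega

lemma residue {C : CartanADE J} {D : DiagAut C} {ξ : J → ℤ} (hξ : IsHeightFunction C D ξ)
    (j : J) : orbitSize D.σ j = 1 ∨ (orbitSize D.σ j = orderOf D.σ ∧
      ∀ a : ℕ, (2 * (orderOf D.σ : ℤ)) ∣ ξ ((D.σ ^ a) j) - ξ j + 2 * a) := by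
  set S : Set J := {j | orbitSize D.σ j = 1 ∨ (orbitSize D.σ j = orderOf D.σ ∧
      ∀ a : ℕ, (2 * (orderOf D.σ : ℤ)) ∣ ξ ((D.σ ^ a) j) - ξ j + 2 * a)} with hS
  obtain ⟨f, hf⟩ := exists_fixed D j
  have hfS : f ∈ S := Or.inl ((orbitSize_eq_one_iff _ _).2 hf)
  have huniv : S = Set.univ := by
    apply C.indec S ⟨f, hfS⟩
    intro ι hι j hij
    rcases lt_trichotomy (orbitSize D.σ ι) (orbitSize D.σ j) with hlt | heq | hgt
    · right
      refine ⟨size_top hξ hij hlt, ?_⟩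
      obtain ⟨j0, ⟨h1, -, h3⟩, -⟩ := hξ.2 ι j hij hlt
      have hall : ∀ a : ℕ, (2 * (orderOf D.σ : ℤ)) ∣ ξ ((D.σ ^ a) j0) - ξ j0 + 2 * a := by
        intro a
        have h4 := h3 (a % orderOf D.σ) (Nat.mod_lt _ (orderOf_pos _))
        rw [pow_mod_orderOf] at h4
        have h5 : (a : ℤ) = (a % orderOf D.σ : ℕ) + orderOf D.σ * (a / orderOf D.σ : ℕ) := by
          exact_mod_cast (Nat.mod_add_div a (orderOf D.σ)).symm
        refine ⟨(a / orderOf D.σ : ℕ), ?_⟩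
        rw [h4]
        linear_combination 2 * h5
      obtain ⟨b, rfl⟩ := h1.symm'
      intro a
      have e1 := hall (a + b)
      have e2 := hall b
      rw [← Equiv.Perm.mul_apply, ← pow_add]
      have := dvd_sub e1 e2
      push_cast at this
      exact this.elim fun q hq => ⟨q, by linear_combination hq⟩
    · rcases hι with h1 | ⟨h1, h2⟩
      · exact Or.inl (heq ▸ h1)
      · refine Or.inr ⟨heq ▸ h1, ?_⟩
        intro a
        have e0 := hξ.1 ι j hij heq
        have e1 := hξ.1 ((D.σ ^ a) ι) ((D.σ ^ a) j) (by rw [compat_pow, hij])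
          (by rw [← (sameOrbit_pow D.σ ι a).size, ← (sameOrbit_pow D.σ j a).size, heq])
        rw [← (sameOrbit_pow D.σ ι a).size, h1] at e1
        rw [h1] at e0
        obtain ⟨q, hq⟩ := h2 a
        have hr : (0 : ℤ) ≤ orderOf D.σ := by positivity
        rcases abs_cases (ξ ι - ξ j) with ⟨u, _⟩ | ⟨u, _⟩ <;>
        rcases abs_cases (ξ ((D.σ ^ a) ι) - ξ ((D.σ ^ a) j)) with ⟨v, _⟩ | ⟨v, _⟩ <;>
        rw [u] at e0 <;> rw [v] at e1
        · exact ⟨q, by linear_combination hq + e0 - e1⟩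
        · exact ⟨q + 1, by linear_combination hq + e0 + e1⟩
        · exact ⟨q - 1, by linear_combination hq - e0 - e1⟩
        · exact ⟨q, by linear_combination hq - e0 + e1⟩
    · exact Or.inl (size_one_of_lt D (by rw [C.symm, hij]) hgt)
  have : j ∈ S := by rw [huniv]; exact Set.mem_univ _
  exact this

lemma residue_inj {C : CartanADE J} {D : DiagAut C} {ξ : J → ℤ} (hξ : IsHeightFunction C D ξ)
    {i j : J} (h : SameOrbit D.σ i j) (hd : (2 * (orbitSize D.σ i : ℤ)) ∣ ξ j - ξ i) :
    i = j := by
  obtain ⟨a, rfl⟩ := h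
  rcases residue hξ i with h1 | ⟨h1, h2⟩
  · rw [orbitSize_eq_one_iff] at h1
    rw [Equiv.Perm.coe_pow]
    exact (Function.iterate_fixed h1 a).symm
  · rw [h1] at hd
    have := dvd_sub (h2 a) hd
    have h3 : (2 * (orderOf D.σ : ℤ)) ∣ 2 * a := this.elim fun q hq => ⟨q, by linear_combination hq⟩
    have h4 : (orderOf D.σ : ℤ) ∣ a := (mul_dvd_mul_iff_left two_ne_zero).1 h3
    have h5 : orderOf D.σ ∣ a := by exact_mod_cast h4
    rw [orderOf_dvd_iff_pow_eq_one.1 h5]; rfl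

/-- The invariant of height functions preserved by reflections at sources. -/
def HInv (C : CartanADE J) (D : DiagAut C) (η : J → ℤ) : Prop :=
  (∀ ι j : J, C.a ι j = -1 → orbitSize D.σ ι = orbitSize D.σ j →
      |η ι - η j| = (orbitSize D.σ ι : ℤ)) ∧
  (∀ ι j : J, C.a ι j = -1 → orbitSize D.σ ι < orbitSize D.σ j →
      orbitSize D.σ j = orderOf D.σ ∧ ∃ j0 : J, SameOrbit D.σ j j0 ∧ |η ι - η j0| = 1 ∧
        ∀ k : ℕ, k < orderOf D.σ → η ((D.σ ^ k) j0) = η j0 - 2 * (k : ℤ))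

lemma adj_fixed {C : CartanADE J} (D : DiagAut C) {ι j j' : J} (hij : C.a ι j = -1)
    (h1 : orbitSize D.σ ι = 1) (h : SameOrbit D.σ j j') : C.a ι j' = -1 := by
  obtain ⟨k, rfl⟩ := h
  have h2 : (D.σ ^ k) ι = ι := by
    rw [Equiv.Perm.coe_pow]
    exact Function.iterate_fixed ((orbitSize_eq_one_iff _ _).1 h1) k
  have := compat_pow D k ι j
  rwa [h2, hij] at this

/-- A source in a big orbit next to a fixed vertex. -/
lemma source_big {C : CartanADE J} {D : DiagAut C} {η : J → ℤ} {ι κ j0 : J}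
    (hκ : η ι < η κ)
    (h1 : SameOrbit D.σ j0 κ) (h2 : |η ι - η j0| = 1)
    (h3 : ∀ k : ℕ, k < orderOf D.σ → η ((D.σ ^ k) j0) = η j0 - 2 * (k : ℤ)) :
    κ = j0 ∧ η ι = η j0 - 1 := by
  obtain ⟨b, hb, rfl⟩ := h1.exists_lt
  rw [h3 b hb] at hκ
  have hb0 : b = 0 := by
    rcases abs_cases (η ι - η j0) with ⟨u, _⟩ | ⟨u, _⟩ <;> omega
  subst hb0
  refine ⟨rfl, ?_⟩
  rcases abs_cases (η ι - η j0) with ⟨u, _⟩ | ⟨u, _⟩ <;> omega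

lemma HInv.step {C : CartanADE J} {D : DiagAut C} {η : J → ℤ} (h : HInv C D η) {κ : J}
    (hκ : IsSource C η κ) :
    HInv C D (fun j => η j - if j = κ then 2 * (orbitSize D.σ κ : ℤ) else 0) := by
  constructor
  · intro ι j hij hs
    have h0 := h.1 ι j hij hs
    have hne := adj_ne hij
    dsimp only
    by_cases h1 : ι = κ
    · subst h1
      have := hκ j hij
      rw [if_pos rfl, if_neg hne.symm]
      rw [abs_of_pos (by omega)] at h0
      rw [abs_of_neg (by omega)]; omega
    · by_cases h2 : j = κ
      · subst h2
        have := hκ ι (by rw [C.symm, hij])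
        rw [if_pos rfl, if_neg h1]
        rw [abs_of_neg (by omega)] at h0
        rw [abs_of_pos (by omega)]; omega
      · rw [if_neg h1, if_neg h2]; simpa using h0
  · intro ι j hij hlt
    obtain ⟨hr, j0, hj0, habs, hall⟩ := h.2 ι j hij hlt
    refine ⟨hr, ?_⟩
    have hs1 := size_one_of_lt D hij hlt
    by_cases hk : SameOrbit D.σ j κ
    · have hlt' := hκ ι (by rw [C.symm]; exact adj_fixed D hij hs1 hk)
      obtain ⟨rfl, h2⟩ := source_big hlt' (hj0.symm'.trans' hk) habs hall
      have hικ : ι ≠ κ := by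
        rintro rfl
        omega
      have hsz : orbitSize D.σ κ = orderOf D.σ := by rw [← hj0.size, hr]
      have hr2 : 1 < orderOf D.σ := by omega
      have hσ : D.σ κ ≠ κ := by
        intro h
        have := (orbitSize_eq_one_iff D.σ κ).2 h
        omega
      have hσ1 : η (D.σ κ) = η κ - 2 := by simpa using hall 1 hr2
      refine ⟨D.σ κ, hj0.trans' ⟨1, by simp⟩, ?_, ?_⟩
      · dsimp only
        rw [if_neg hικ, if_neg hσ, hσ1, h2]
        rw [abs_of_pos] <;> linarith
      · intro k hk
        dsimp only
        rw [← Equiv.Perm.mul_apply, ← pow_succ, if_neg hσ, hσ1, hsz]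
        by_cases hk' : k + 1 < orderOf D.σ
        · rw [if_neg (pow_ne_of_lt D.σ κ (Nat.succ_pos k) (by omega)), hall _ hk']
          push_cast; ring
        · have : k + 1 = orderOf D.σ := by omega
          rw [this, pow_orderOf_eq_one]
          simp only [Equiv.Perm.coe_one, id_eq, if_true]
          have : (orderOf D.σ : ℤ) = k + 1 := by exact_mod_cast this.symm
          rw [this]; ring
    · have hn : ∀ k : ℕ, (D.σ ^ k) j0 ≠ κ := by
        rintro k rfl
        exact hk (hj0.trans' ⟨k, rfl⟩)
      have hn0 : j0 ≠ κ := hn 0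
      refine ⟨j0, hj0, ?_, ?_⟩
      · dsimp only
        rw [if_neg hn0]
        by_cases h1 : ι = κ
        · subst h1
          have := hκ j0 (adj_fixed D hij hs1 hj0)
          rw [abs_of_pos (by omega)] at habs
          rw [if_pos rfl, hs1, abs_of_neg] <;> push_cast <;> linarith
        · rw [if_neg h1]; simpa using habs
      · intro k hk
        dsimp only
        rw [if_neg (hn k), if_neg hn0, hall k hk]
        ring

lemma HInv.of_height {C : CartanADE J} {D : DiagAut C} {ξ : J → ℤ}
    (hξ : IsHeightFunction C D ξ) : HInv C D ξ := by
  refine ⟨hξ.1, fun ι j hij hlt => ⟨size_top hξ hij hlt, ?_⟩⟩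
  obtain ⟨j0, h, -⟩ := hξ.2 ι j hij hlt
  exact ⟨j0, h⟩

/-! ### Evolution of heights -/

noncomputable def hgt (σ : Equiv.Perm J) (ξ : J → ℤ) {L : ℕ} (ii : Fin L → J) (n : ℕ) : J → ℤ :=
  heightAfter σ ξ ((List.ofFn ii).take n)

lemma take_succ_ofFn {L : ℕ} (ii : Fin L → J) (n : Fin L) :
    (List.ofFn ii).take (n.1 + 1) = (List.ofFn ii).take n.1 ++ [ii n] := by
  rw [List.take_succ_eq_append_getElem (by simp)]
  simp

lemma hgt_succ (σ : Equiv.Perm J) (ξ : J → ℤ) {L : ℕ} (ii : Fin L → J) (n : Fin L) :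
    hgt σ ξ ii (n.1 + 1) = fun j => hgt σ ξ ii n.1 j -
      if j = ii n then 2 * (orbitSize σ (ii n) : ℤ) else 0 := by
  unfold hgt heightAfter
  rw [take_succ_ofFn, List.foldl_append]
  rfl

lemma hgt_zero (σ : Equiv.Perm J) (ξ : J → ℤ) {L : ℕ} (ii : Fin L → J) :
    hgt σ ξ ii 0 = ξ := rfl

lemma hgt_inv {C : CartanADE J} {D : DiagAut C} {ξ : J → ℤ} (hξ : IsHeightFunction C D ξ)
    {L : ℕ} {ii : Fin L → J} (ha : IsAdapted C D ξ ii) (n : ℕ) (hn : n ≤ L) :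
    HInv C D (hgt D.σ ξ ii n) := by
  induction n with
  | zero => exact HInv.of_height hξ
  | succ n ih =>
    have := hgt_succ D.σ ξ ii ⟨n, hn⟩
    dsimp only at this
    rw [this]
    exact (ih (by omega)).step (ha ⟨n, hn⟩)

lemma hgt_anti (σ : Equiv.Perm J) (ξ : J → ℤ) {L : ℕ} (ii : Fin L → J) (j : J) {n m : ℕ}
    (hnm : n ≤ m) (hm : m ≤ L) : hgt σ ξ ii m j ≤ hgt σ ξ ii n j := by
  induction m, hnm using Nat.le_induction with
  | base => exact le_rfl
  | succ m hnm ih =>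
    have := hgt_succ σ ξ ii ⟨m, hm⟩
    dsimp only at this
    rw [this]
    have := ih (by omega)
    dsimp only
    split_ifs <;> omega

lemma hgt_dvd (σ : Equiv.Perm J) (ξ : J → ℤ) {L : ℕ} (ii : Fin L → J) (j : J) {n m : ℕ}
    (hnm : n ≤ m) (hm : m ≤ L) :
    (2 * (orbitSize σ j : ℤ)) ∣ hgt σ ξ ii n j - hgt σ ξ ii m j := by
  induction m, hnm using Nat.le_induction with
  | base => simp
  | succ m hnm ih =>
    have := hgt_succ σ ξ ii ⟨m, hm⟩
    dsimp only at this
    rw [this]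
    have := ih (by omega)
    dsimp only
    split_ifs with h
    · rw [← h]
      exact this.elim fun q hq => ⟨q + 1, by linear_combination hq⟩
    · simpa using this

lemma hgt_hit (σ : Equiv.Perm J) (ξ : J → ℤ) {L : ℕ} (ii : Fin L → J) (j : J) (q : ℤ) {n m : ℕ}
    (hnm : n ≤ m) (hm : m ≤ L) (h1 : q ≤ hgt σ ξ ii n j) (h2 : hgt σ ξ ii m j < q)
    (hd : (2 * (orbitSize σ j : ℤ)) ∣ hgt σ ξ ii n j - q) :
    ∃ t : Fin L, n ≤ t.1 ∧ t.1 < m ∧ ii t = j ∧ hgt σ ξ ii t.1 j = q := by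
  induction m, hnm using Nat.le_induction with
  | base => omega
  | succ m hnm ih =>
    by_cases h3 : hgt σ ξ ii m j < q
    · obtain ⟨t, a, b, c⟩ := ih (by omega) h3
      exact ⟨t, a, by omega, c⟩
    · have := hgt_succ σ ξ ii ⟨m, hm⟩
      dsimp only at this
      rw [this] at h2
      dsimp only at h2
      have hs := orbitSize_pos σ j
      split_ifs at h2 with h
      · refine ⟨⟨m, hm⟩, hnm, Nat.lt_succ_self m, h.symm, ?_⟩
        rw [← h] at h2
        dsimp only
        have hd2 := hgt_dvd σ ξ ii j hnm (by omega : m ≤ L)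
        have hd3 := dvd_sub hd hd2
        have e : hgt σ ξ ii n j - q - (hgt σ ξ ii n j - hgt σ ξ ii m j)
          = hgt σ ξ ii m j - q := by ring
        rw [e] at hd3
        have := Int.eq_zero_of_dvd_of_nonneg_of_lt (by omega) (by omega) hd3
        omega
      · omega

lemma index_inj {C : CartanADE J} {D : DiagAut C} {ξ : J → ℤ} (hξ : IsHeightFunction C D ξ)
    {L : ℕ} {ii : Fin L → J} {t t' : Fin L} (h : SameOrbit D.σ (ii t) (ii t'))
    (hh : heightAt D.σ ξ ii t = heightAt D.σ ξ ii t') : t = t' := by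
  change hgt D.σ ξ ii t.1 (ii t) = hgt D.σ ξ ii t'.1 (ii t') at hh
  have d1 := hgt_dvd D.σ ξ ii (ii t) (Nat.zero_le t.1) t.2.le
  have d2 := hgt_dvd D.σ ξ ii (ii t') (Nat.zero_le t'.1) t'.2.le
  rw [hgt_zero] at d1 d2
  rw [← h.size] at d2
  have e : ii t = ii t' := by
    apply residue_inj hξ h
    have := dvd_sub d2 d1
    rw [hh] at this
    exact this.elim fun q hq => ⟨q, by linear_combination hq⟩
  have aux : ∀ u v : Fin L, ii u = ii v →
      hgt D.σ ξ ii u.1 (ii u) = hgt D.σ ξ ii v.1 (ii v) → ¬ u < v := by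
    intro u v huv hh hlt
    have h1 := hgt_anti D.σ ξ ii (ii v) (Nat.succ_le_of_lt hlt) v.2.le
    have h2 := hgt_succ D.σ ξ ii u
    rw [Nat.succ_eq_add_one, h2] at h1
    have := orbitSize_pos D.σ (ii u)
    rw [huv] at hh
    simp only [huv, if_true] at h1
    rw [huv] at this
    omega
  exact le_antisymm (not_lt.1 (aux t' t e.symm hh.symm)) (not_lt.1 (aux t t' e hh))

/-! ### The root identity -/

lemma reflS_sub_smul (C : CartanADE J) (ι : J) (v w : J → ℤ) (c : ℤ) :
    reflS C ι (v - c • w) = reflS C ι v - c • reflS C ι w := by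
  funext j
  simp only [reflS, Pi.sub_apply, Pi.smul_apply, smul_eq_mul, sub_mul, Finset.sum_sub_distrib,
    mul_assoc, ← Finset.mul_sum]
  ring

lemma applyRefls_sub_smul (C : CartanADE J) (l : List J) (v w : J → ℤ) (c : ℤ) :
    applyRefls C l (v - c • w) = applyRefls C l v - c • applyRefls C l w := by
  induction l with
  | nil => rfl
  | cons a l ih =>
    simp only [applyRefls, List.foldr_cons] at ih ⊢
    rw [ih, reflS_sub_smul]

lemma reflS_simple (C : CartanADE J) (ι j : J) :
    reflS C ι (simpleRoot j) = simpleRoot j - C.a j ι • simpleRoot ι := by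
  funext x
  simp [reflS, simpleRoot]

lemma applyRefls_succ (C : CartanADE J) {L : ℕ} (ii : Fin L → J) (n : Fin L) (j : J) :
    applyRefls C ((List.ofFn ii).take (n.1 + 1)) (simpleRoot j) =
      applyRefls C ((List.ofFn ii).take n.1) (simpleRoot j) - C.a j (ii n) • betaOf C ii n := by
  rw [take_succ_ofFn]
  have : applyRefls C ((List.ofFn ii).take n.1 ++ [ii n]) (simpleRoot j)
    = applyRefls C ((List.ofFn ii).take n.1) (reflS C (ii n) (simpleRoot j)) := by
    simp [applyRefls, List.foldr_append]
  rw [this, reflS_simple, applyRefls_sub_smul]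
  rfl

lemma root_identity (C : CartanADE J) {L : ℕ} (ii : Fin L → J) (k k' : Fin L) (hk : k < k')
    (h1 : ii k' = ii k) (hno : ∀ t, k < t → t < k' → ii t ≠ ii k) :
    betaOf C ii k + betaOf C ii k' -
      ∑ t ∈ Finset.univ.filter (fun t : Fin L => k < t ∧ t < k' ∧ C.a (ii k) (ii t) = -1),
        betaOf C ii t = 0 := by
  have key : ∀ n : ℕ, k.1 + 1 ≤ n → n ≤ k'.1 →
      applyRefls C ((List.ofFn ii).take n) (simpleRoot (ii k)) = - betaOf C ii k +
      ∑ t ∈ Finset.univ.filter (fun t : Fin L => k < t ∧ t.1 < n ∧ C.a (ii k) (ii t) = -1),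
        betaOf C ii t := by
    intro n hn
    induction n, hn using Nat.le_induction with
    | base =>
      intro _
      rw [applyRefls_succ, C.diag, Finset.sum_eq_zero]
      · change betaOf C ii k - (2 : ℤ) • betaOf C ii k = _
        rw [two_smul]; abel
      · intro t ht
        simp only [Finset.mem_filter] at ht
        have := Fin.lt_def.1 ht.2.1
        omega
    | succ n hn ih =>
      intro hn'
      have hnL : n < L := by omega
      have := applyRefls_succ C ii ⟨n, hnL⟩ (ii k)
      dsimp only at this
      rw [this, ih (by omega)]
      have hne := hno ⟨n, hnL⟩ (Fin.lt_def.2 hn) (Fin.lt_def.2 hn')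
      rcases C.offDiag (ii k) (ii ⟨n, hnL⟩) hne.symm with h | h
      · rw [h, zero_smul, sub_zero]
        congr 1
        apply Finset.sum_congr _ (fun _ _ => rfl)
        ext t
        simp only [Finset.mem_filter, Finset.mem_univ, true_and]
        constructor
        · rintro ⟨a, b, c⟩; exact ⟨a, by omega, c⟩
        · rintro ⟨a, b, c⟩
          refine ⟨a, ?_, c⟩
          rcases Nat.lt_succ_iff_lt_or_eq.1 b with b | b
          · exact b
          · have : t = ⟨n, hnL⟩ := Fin.ext b
            subst this
            omega
      · have : Finset.univ.filter (fun t : Fin L => k < t ∧ t.1 < n + 1 ∧ C.a (ii k) (ii t) = -1)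
          = insert ⟨n, hnL⟩ (Finset.univ.filter
              (fun t : Fin L => k < t ∧ t.1 < n ∧ C.a (ii k) (ii t) = -1)) := by
          ext t
          simp only [Finset.mem_filter, Finset.mem_univ, true_and, Finset.mem_insert]
          constructor
          · rintro ⟨a, b, c⟩
            rcases Nat.lt_succ_iff_lt_or_eq.1 b with b | b
            · exact Or.inr ⟨a, b, c⟩
            · exact Or.inl (Fin.ext b)
          · rintro (rfl | ⟨a, b, c⟩)
            · exact ⟨Fin.lt_def.2 hn, Nat.lt_succ_self n, h⟩
            · exact ⟨a, by omega, c⟩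
        rw [this, Finset.sum_insert (by simp), h]
        simp only [neg_smul, one_smul]
        abel
  have h2 := key k'.1 (Fin.lt_def.1 hk) le_rfl
  have h3 : betaOf C ii k' = applyRefls C ((List.ofFn ii).take k'.1) (simpleRoot (ii k)) := by
    rw [betaOf, h1]
  rw [h3, h2]
  simp only [Fin.lt_def]
  abel

/-! ### Matching the ℓ-root -/

lemma match_iff {C : CartanADE J} {D : DiagAut C} {ξ : J → ℤ} (hξ : IsHeightFunction C D ξ)
    {c : J → J → ℤ} (hc : IsFoldedCartan C D.σ c) {L : ℕ} {ii : Fin L → J}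
    (ha : IsAdapted C D ξ ii) {k k' : Fin L} {p : ℤ} (hkk : k < k') (h1 : ii k' = ii k)
    (hp : heightAt D.σ ξ ii k = p + orbitSize D.σ (ii k))
    (hm : heightAt D.σ ξ ii k' = p - orbitSize D.σ (ii k)) (y : J × ℤ) :
    (∃ t : Fin L, (k < t ∧ t < k' ∧ C.a (ii k) (ii t) = -1) ∧
      SameOrbit D.σ (ii t) y.1 ∧ y.2 = heightAt D.σ ξ ii t) ↔
    ((¬ SameOrbit D.σ (ii k) y.1) ∧
          ∃ n : ℤ, 1 ≤ n ∧ n ≤ -(c y.1 (ii k)) ∧ y.2 = p - c y.1 (ii k) + 1 - 2 * n) := by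
  obtain ⟨y1, q⟩ := y
  dsimp only
  set ι := ii k with hι
  set σ := D.σ with hσ
  set s := orbitSize σ ι with hs
  have hspos : 0 < s := orbitSize_pos _ _
  change hgt σ ξ ii k.1 ι = p + s at hp
  have hm' : hgt σ ξ ii k'.1 ι = p - s := by rw [← h1]; exact hm
  have hsrc : ∀ j, C.a ι j = -1 → hgt σ ξ ii k.1 j < p + s := by
    intro j hj
    rw [← hp]
    exact ha k j hj
  have hsrc' : ∀ j, C.a ι j = -1 → hgt σ ξ ii k'.1 j < p - s := by
    intro j hj
    rw [← hm', ← h1]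
    exact ha k' j (by rw [h1]; exact hj)
  have hinv := hgt_inv hξ ha k.1 k.2.le
  -- values of heights of neighbours at time `k`
  have veq : ∀ j, C.a ι j = -1 → s = orbitSize σ j → hgt σ ξ ii k.1 j = p := by
    intro j hj he
    have h2 : |hgt σ ξ ii k.1 ι - hgt σ ξ ii k.1 j| = (s : ℤ) := hinv.1 ι j hj he
    have h3 := hsrc j hj
    rw [hp, abs_of_pos (by omega)] at h2
    omega
  have vgt : ∀ j, C.a ι j = -1 → orbitSize σ j < s →
      orbitSize σ j = 1 ∧ hgt σ ξ ii k.1 j = p + s - 1 := by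
    intro j hj hlt
    have hj' : C.a j ι = -1 := by rw [C.symm, hj]
    obtain ⟨-, j0, a1, a2, a3⟩ := hinv.2 j ι hj' hlt
    obtain ⟨e1, e2⟩ := source_big (by rw [hp]; exact hsrc j hj) a1.symm' a2 a3
    refine ⟨size_one_of_lt D hj' hlt, ?_⟩
    rw [e2, ← e1, hp]
  -- values of the folded Cartan matrix
  have cval : ∀ j, C.a ι j = -1 → SameOrbit σ j y1 →
      ((c y1 ι : ℚ) = -(max 1 ((s : ℚ) / (orbitSize σ j : ℚ)))) := by
    intro j hj hjy
    rw [hc y1 ι, if_neg, if_pos, hjy.size]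
    · exact ⟨j, ι, hjy.symm', SameOrbit.refl' _ _, by rw [C.symm, hj]⟩
    · exact fun h => adj_not_same D hj (hjy.trans' h).symm'
  have cle : ∀ j, C.a ι j = -1 → SameOrbit σ j y1 → s ≤ orbitSize σ j → c y1 ι = -1 := by
    intro j hj hjy hle
    have h2 := cval j hj hjy
    have h3 : (0 : ℚ) < orbitSize σ j := by exact_mod_cast orbitSize_pos σ j
    have h4 : (s : ℚ) / orbitSize σ j ≤ 1 := by
      rw [div_le_one h3]; exact_mod_cast hle
    rw [max_eq_left h4] at h2
    exact_mod_cast h2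
  have cgt : ∀ j, C.a ι j = -1 → SameOrbit σ j y1 → orbitSize σ j = 1 → c y1 ι = -s := by
    intro j hj hjy he
    have h2 := cval j hj hjy
    rw [he] at h2
    have h4 : (1 : ℚ) ≤ s := by exact_mod_cast hspos
    rw [Nat.cast_one, div_one, max_eq_right h4] at h2
    exact_mod_cast h2
  constructor
  · rintro ⟨t, ⟨hkt, htk, hadj⟩, hsame, rfl⟩
    refine ⟨fun h => adj_not_same D hadj (h.trans' hsame.symm'), ?_⟩
    have hq : heightAt σ ξ ii t = hgt σ ξ ii t.1 (ii t) := rfl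
    have hqle := hgt_anti σ ξ ii (ii t) (Fin.lt_def.1 hkt).le t.2.le
    have hqd := hgt_dvd σ ξ ii (ii t) (Fin.lt_def.1 hkt).le t.2.le
    have hqlt := hsrc _ hadj
    have hqgt : p - s < hgt σ ξ ii t.1 (ii t) := by
      have e1 := hgt_anti σ ξ ii ι (Fin.lt_def.1 htk).le k'.2.le
      have e2 : hgt σ ξ ii t.1 ι < hgt σ ξ ii t.1 (ii t) := ha t ι (by rw [C.symm, hadj])
      omega
    rw [hq]
    rcases lt_trichotomy s (orbitSize σ (ii t)) with hlt | heq | hgt'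
    · have hs1 : s = 1 := size_one_of_lt D hadj hlt
      refine ⟨1, le_rfl, ?_, ?_⟩ <;> rw [cle _ hadj hsame hlt.le]
      · norm_num
      · omega
    · have hv := veq _ hadj heq
      refine ⟨1, le_rfl, ?_, ?_⟩ <;> rw [cle _ hadj hsame heq.le]
      · norm_num
      · have := Int.eq_zero_of_dvd_of_nonneg_of_lt (by omega) (by omega) hqd
        omega
    · obtain ⟨hs1, hv⟩ := vgt _ hadj hgt'
      rw [cgt _ hadj hsame hs1]
      rw [hs1, hv] at hqd
      obtain ⟨z, hz⟩ := hqd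
      rw [hv] at hqle
      refine ⟨z + 1, ?_, ?_, ?_⟩ <;> push_cast at hz ⊢ <;> omega
  · rintro ⟨hns, n, hn1, hn2, hq⟩
    have hadj0 : adjOrbit C σ y1 ι := by
      by_contra hna
      have h2 := hc y1 ι
      rw [if_neg (fun h => hns h.symm'), if_neg hna] at h2
      have h3 : c y1 ι = 0 := by exact_mod_cast h2
      omega
    obtain ⟨x, ι', hx, hι', hxι⟩ := hadj0
    obtain ⟨j, hxj, hadj⟩ := adj_transport D (by rw [C.symm, hxι] : C.a ι' x = -1) hι'.symm'
    have hjy : SameOrbit σ j y1 := (hx.trans' hxj).symm'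
    -- it is enough to find a suitable neighbour
    have fin : ∀ j, C.a ι j = -1 → SameOrbit σ j y1 → q ≤ hgt σ ξ ii k.1 j → p - s < q →
        (2 * (orbitSize σ j : ℤ)) ∣ hgt σ ξ ii k.1 j - q →
        ∃ t : Fin L, (k < t ∧ t < k' ∧ C.a ι (ii t) = -1) ∧
          SameOrbit σ (ii t) y1 ∧ q = heightAt σ ξ ii t := by
      intro j hadj hjy hle hlt hd
      obtain ⟨t, t1, t2, t3, t4⟩ := hgt_hit σ ξ ii j q (Fin.lt_def.1 hkk).le k'.2.le hle
        ((hsrc' j hadj).trans hlt) hd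
      have hne : k ≠ t := by
        rintro rfl
        exact adj_ne hadj (hι.trans t3)
      refine ⟨t, ⟨lt_of_le_of_ne (Fin.le_def.2 t1) hne, Fin.lt_def.2 t2, ?_⟩, ?_, ?_⟩
      · rw [t3, hadj]
      · rw [t3]; exact hjy
      · rw [← t4, ← t3]; rfl
    rcases lt_trichotomy s (orbitSize σ j) with hlt | heq | hgt'
    · have hs1 : s = 1 := size_one_of_lt D hadj hlt
      obtain ⟨-, j0, a1, a2, a3⟩ := hinv.2 ι j hadj hlt
      have hadj' := adj_fixed D hadj hs1 a1
      have hcv := cle j hadj hjy hlt.le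
      have hqp : q = p := by rw [hcv] at hn2 hq; omega
      have h3 := hsrc j0 hadj'
      change |hgt σ ξ ii k.1 ι - hgt σ ξ ii k.1 j0| = 1 at a2
      have hv : hgt σ ξ ii k.1 j0 = p := by
        rw [hp, hs1, abs_of_pos (by rw [hs1] at h3; omega)] at a2
        push_cast at a2; omega
      exact fin j0 hadj' (a1.symm'.trans' hjy) (by omega) (by omega) (by rw [hv, hqp]; simp)
    · have hv := veq j hadj heq
      have hcv := cle j hadj hjy heq.le
      have hqp : q = p := by rw [hcv] at hn2 hq; omega
      exact fin j hadj hjy (by omega) (by omega) (by rw [hv, hqp]; simp)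
    · obtain ⟨hs1, hv⟩ := vgt j hadj hgt'
      have hcv := cgt j hadj hjy hs1
      rw [hcv] at hn2 hq
      refine fin j hadj hjy (by omega) (by omega) ?_
      rw [hv, hs1]
      exact ⟨n - 1, by push_cast; linarith⟩

/-- Lemma 6.5(i): if `(ι, p ± 𝗌_{\barι}) ∈ Im Ω̃_Q`, then there is a
unique `𝐦 ∈ ℤ^{R⁺}` with `Ω_Q(𝐦) = α_{\barι,p}`, and it satisfies `Σ_α 𝐦(α)α = 0`. -/
theorem statement12 (C : CartanADE J) (D : DiagAut C) (ξ : J → ℤ)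
    (hξ : IsHeightFunction C D ξ)
    (c : J → J → ℤ) (hc : IsFoldedCartan C D.σ c)
    (L : ℕ) (ii : Fin L → J) (hr : IsReducedWord C ii) (ha : IsAdapted C D ξ ii)
    (ι : J) (p : ℤ)
    (hm : InImOmega D.σ ξ ii (ι, p - (orbitSize D.σ ι : ℤ)))
    (hp : InImOmega D.σ ξ ii (ι, p + (orbitSize D.σ ι : ℤ))) :
    (∃! m : (J → ℤ) → ℤ, (∀ v : J → ℤ, v ∉ posRoots C → m v = 0) ∧
        OmegaQmap C D.σ ξ ii m = lrootF D.σ c ι p) ∧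
    (∀ m : (J → ℤ) → ℤ, (∀ v : J → ℤ, v ∉ posRoots C → m v = 0) →
        OmegaQmap C D.σ ξ ii m = lrootF D.σ c ι p →
        ∑ᶠ v ∈ posRoots C, m v • v = (0 : J → ℤ)) := by
  obtain ⟨k', hk'1, hm⟩ := hm
  obtain ⟨k, hk1, hp⟩ := hp
  dsimp only at hk'1 hk1 hm hp
  subst hk1
  have hspos := orbitSize_pos D.σ (ii k)
  have hm' : hgt D.σ ξ ii k'.1 (ii k) = p - orbitSize D.σ (ii k) := by
    rw [← hm, ← hk'1]; rfl
  have hp' : hgt D.σ ξ ii k.1 (ii k) = p + orbitSize D.σ (ii k) := hp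
  have hkk : k < k' := by
    by_contra h
    have := hgt_anti D.σ ξ ii (ii k) (Fin.le_def.1 (not_lt.1 h)) k.2.le
    omega
  have hno : ∀ t, k < t → t < k' → ii t ≠ ii k := by
    intro t h1 h2 h3
    have e1 := hgt_anti D.σ ξ ii (ii k) (Nat.succ_le_of_lt (Fin.lt_def.1 h1)) t.2.le
    have e2 := hgt_anti D.σ ξ ii (ii k) (Nat.succ_le_of_lt (Fin.lt_def.1 h2)) k'.2.le
    rw [Nat.succ_eq_add_one, hgt_succ] at e1 e2
    simp only [h3, if_true] at e1 e2
    omega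
  -- roots
  have hfin : (posRoots C).Finite := by
    apply Set.finite_of_ncard_ne_zero
    rw [← hr.1]
    have := k.2
    omega
  have hrange : Set.range (betaOf C ii) = posRoots C := by
    apply Set.eq_of_subset_of_ncard_le _ _ hfin
    · rintro _ ⟨t, rfl⟩
      exact hr.2.2 t
    · rw [← Set.image_univ, Set.ncard_image_of_injective _ hr.2.1, Set.ncard_univ, Nat.card_fin,
        ← hr.1]
  -- uniqueness
  have hval : ∀ (m : (J → ℤ) → ℤ) (t : Fin L),
      OmegaQmap C D.σ ξ ii m (ii t, heightAt D.σ ξ ii t) = m (betaOf C ii t) := by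
    intro m t
    rw [OmegaQmap, Finset.sum_apply, Finset.sum_eq_single t]
    · simp [varpiF, SameOrbit.refl']
    · intro t' _ hne
      have : ¬ (SameOrbit D.σ (ii t') (ii t) ∧ heightAt D.σ ξ ii t = heightAt D.σ ξ ii t') :=
        fun h => hne (index_inj hξ h.1 h.2.symm)
      simp [varpiF, this]
    · simp
  have huniq : ∀ m m' : (J → ℤ) → ℤ, (∀ v : J → ℤ, v ∉ posRoots C → m v = 0) →
      (∀ v : J → ℤ, v ∉ posRoots C → m' v = 0) →
      OmegaQmap C D.σ ξ ii m = OmegaQmap C D.σ ξ ii m' → m = m' := by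
    intro m m' h1 h2 h
    funext v
    by_cases hv : v ∈ posRoots C
    · rw [← hrange] at hv
      obtain ⟨t, rfl⟩ := hv
      rw [← hval m, ← hval m', h]
    · rw [h1 v hv, h2 v hv]
  -- the solution
  set T : Finset (Fin L) :=
    Finset.univ.filter (fun t : Fin L => k < t ∧ t < k' ∧ C.a (ii k) (ii t) = -1) with hT
  set g : Fin L → ℤ := fun t =>
    (if t = k then 1 else 0) + (if t = k' then 1 else 0) - (if t ∈ T then 1 else 0) with hg
  obtain ⟨m0, hm0, hm0'⟩ : ∃ m0 : (J → ℤ) → ℤ, (∀ v : J → ℤ, v ∉ posRoots C → m0 v = 0) ∧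
      ∀ t, m0 (betaOf C ii t) = g t := by
    refine ⟨Function.extend (betaOf C ii) g 0, ?_, fun t => hr.2.1.extend_apply _ _ _⟩
    intro v hv
    rw [Function.extend_apply']
    · rfl
    · rintro ⟨t, rfl⟩
      exact hv (hr.2.2 t)
  have gsum : ∀ {M : Type} [AddCommGroup M] (f : Fin L → M),
      ∑ t, g t • f t = f k + f k' - ∑ t ∈ T, f t := by
    intro M _ f
    simp only [hg, sub_smul, add_smul, ite_smul, one_smul, zero_smul, Finset.sum_sub_distrib,
      Finset.sum_add_distrib, Finset.sum_ite_eq', Finset.mem_univ, if_true]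
    congr 1
    rw [Finset.sum_ite_mem, Finset.univ_inter]
  have hΩ : OmegaQmap C D.σ ξ ii m0 = lrootF D.σ c (ii k) p := by
    unfold OmegaQmap
    simp only [hm0']
    rw [gsum]
    funext y
    simp only [Pi.sub_apply, Pi.add_apply, Finset.sum_apply, lrootF, hk'1, hm, hp]
    congr 1
    have hmi := match_iff hξ hc ha hkk hk'1 hp hm y
    by_cases hex : ∃ t : Fin L, (k < t ∧ t < k' ∧ C.a (ii k) (ii t) = -1) ∧
      SameOrbit D.σ (ii t) y.1 ∧ y.2 = heightAt D.σ ξ ii t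
    · rw [if_pos (hmi.1 hex)]
      obtain ⟨t, h1, h2⟩ := hex
      rw [Finset.sum_eq_single t]
      · simp only [varpiF]
        rw [if_pos h2]
      · intro t' _ hne
        simp only [varpiF]
        rw [if_neg]
        rintro ⟨h3, h4⟩
        exact hne (index_inj hξ (h3.trans' h2.1.symm') (h4.symm.trans h2.2))
      · intro h
        exact absurd (by rw [hT, Finset.mem_filter]; exact ⟨Finset.mem_univ _, h1⟩) h
    · rw [if_neg (fun h => hex (hmi.2 h))]
      apply Finset.sum_eq_zero
      intro t ht
      simp only [varpiF]
      rw [if_neg]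
      exact fun h => hex ⟨t, (Finset.mem_filter.1 ht).2, h⟩
  refine ⟨⟨m0, ⟨hm0, hΩ⟩, ?_⟩, ?_⟩
  · rintro m ⟨h1, h2⟩
    exact huniq m m0 h1 hm0 (h2.trans hΩ.symm)
  · intro m h1 h2
    have : m = m0 := huniq m m0 h1 hm0 (h2.trans hΩ.symm)
    subst this
    rw [← hrange, finsum_mem_range hr.2.1, finsum_eq_sum_of_fintype]
    simp only [hm0']
    rw [gsum]
    exact root_identity C ii k k' hkk hk'1 hno

end QDatumPaper
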